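/- The number of cyclic permutations τ of {1,...,n} (full n-cycles) such that the product (1 2 3 ... n)·τ has exactly k cycles is equal to (2/(n(n+1)))·c(n+1,k) if n−k is even, and is 0 if n−k is odd, where c(n+1,k) is the unsigned Stirling number of the first kind. -/

import Mathlib

open Finset
open scoped Classical

/-- Number of cycles of a permutation, counting fixed points as cycles of length 1. -/
noncomputable def cycleCount {α : Type*} [Fintype α] [DecidableEq α] (σ : Equiv.Perm α) : ℕ :=
  σ.cycleType.card + (Finset.univ.filter fun x => σ x = x).card

/-- The full cycle type of a permutation, including parts of size 1 for fixed points. -/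
noncomputable def fullCycleType {α : Type*} [Fintype α] [DecidableEq α] (σ : Equiv.Perm α) :
    Multiset ℕ :=
  σ.cycleType + Multiset.replicate (Finset.univ.filter fun x => σ x = x).card 1

/-- The set of full `n`-cycles in the symmetric group on `Fin n`. -/
noncomputable def fullCycles (n : ℕ) : Finset (Equiv.Perm (Fin n)) :=
  Finset.univ.filter fun σ => fullCycleType σ = {n}

/-- Unsigned Stirling number of the first kind: the number of permutations of `m`
elements with exactly `k` cycles. -/
noncomputable def stirling1 (m k : ℕ) : ℕ :=
  (Finset.univ.filter fun σ : Equiv.Perm (Fin m) => cycleCount σ = k).card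



namespace CycMul

open Equiv Equiv.Perm

lemma cycleCount_eq {α : Type*} [Fintype α] [DecidableEq α] (σ : Perm α) :
    cycleCount σ = Nat.card (Quotient (SameCycle.setoid σ)) := by
  let f : α → Perm α × Option α := fun x => (σ.cycleOf x, if σ x = x then some x else none)
  have hf : ∀ x y, f x = f y ↔ σ.SameCycle x y := by
    intro x y
    constructor
    · intro h
      simp only [f, Prod.mk.injEq] at h
      obtain ⟨h1, h2⟩ := h
      by_cases hx : σ x = x
      · by_cases hy : σ y = y
        · simp only [hx, hy, if_true, Option.some.injEq] at h2
          rw [h2]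
        · simp [hx, hy] at h2
      · by_cases hy : σ y = y
        · simp [hx, hy] at h2
        · exact (sameCycle_iff_cycleOf_eq_of_mem_support (mem_support.2 hx) (mem_support.2 hy)).2 h1
    · intro h
      have h2 := h.apply_eq_self_iff
      simp only [f, Prod.mk.injEq]
      refine ⟨h.cycleOf_eq, ?_⟩
      by_cases hx : σ x = x
      · have hy := h2.1 hx
        have := h.eq_of_left hx
        subst this
        rfl
      · have hy : ¬ σ y = y := fun hy => hx (h2.2 hy)
        simp [hx, hy]
  have h1 : Nat.card (Quotient (SameCycle.setoid σ)) = (Finset.univ.image f).card := by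
    have hs : SameCycle.setoid σ = Setoid.ker f := by
      ext x y
      exact (hf x y).symm
    rw [hs, Nat.card_congr (Setoid.quotientKerEquivRange f), ← Nat.card_eq_finsetCard]
    exact Nat.card_congr (Equiv.subtypeEquivRight (by simp))
  have h2 : Finset.univ.image f = (σ.cycleFactorsFinset.image (fun c => ((c, none) : Perm α × Option α))) ∪
      ((Finset.univ.filter fun x => σ x = x).image (fun x => ((1, some x) : Perm α × Option α))) := by
    ext ⟨c, o⟩
    simp only [Finset.mem_image, Finset.mem_univ, true_and, Finset.mem_union, Finset.mem_filter, f,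
      Prod.mk.injEq]
    constructor
    · rintro ⟨x, h, h'⟩
      subst h h'
      by_cases hx : σ x = x
      · right
        exact ⟨x, hx, ((cycleOf_eq_one_iff σ).2 hx).symm, by simp [hx]⟩
      · left
        exact ⟨_, cycleOf_mem_cycleFactorsFinset_iff.2 (mem_support.2 hx), rfl, by simp [hx]⟩
    · rintro (⟨c, hc, rfl, rfl⟩ | ⟨x, hx, rfl, rfl⟩)
      · obtain ⟨x, hx⟩ := (mem_cycleFactorsFinset_iff.1 hc).1.nonempty_support
        refine ⟨x, (cycle_is_cycleOf hx hc).symm, ?_⟩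
        have := mem_cycleFactorsFinset_support_le hc hx
        rw [mem_support] at this
        simp [this]
      · exact ⟨x, (cycleOf_eq_one_iff σ).2 hx, by simp [hx]⟩
  rw [h1, h2, Finset.card_union_of_disjoint, Finset.card_image_of_injective, Finset.card_image_of_injective, cycleCount]
  · simp [cycleType_def]
  · intro a b h
    simpa using h
  · intro a b h
    simpa using h
  · rw [Finset.disjoint_left]
    rintro ⟨c, o⟩ h h'
    simp only [Finset.mem_image, Prod.mk.injEq] at h h'
    obtain ⟨_, _, _, rfl⟩ := h
    simp at h'

lemma inv_card {α : Type*} [Fintype α] [DecidableEq α] (σ : Perm α) :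
    Nat.card {φ : α → ZMod 2 // ∀ x, φ (σ x) = φ x} = 2 ^ cycleCount σ := by
  rw [cycleCount_eq]
  have e : {φ : α → ZMod 2 // ∀ x, φ (σ x) = φ x} ≃ (Quotient (SameCycle.setoid σ) → ZMod 2) :=
    { toFun := fun φ => Quotient.lift φ.1 (by
        rintro x y ⟨i, rfl⟩
        have hz : ∀ (i : ℕ) x, φ.1 ((σ ^ i) x) = φ.1 x := by
          intro i
          induction i with
          | zero => simp
          | succ k ih => intro x; rw [pow_succ', Perm.mul_apply, φ.2, ih]
        cases i with
        | ofNat i => simpa using (hz i x).symm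
        | negSucc i =>
          have := hz (i+1) ((σ ^ (Int.negSucc i)) x)
          rw [← this]
          simp [zpow_negSucc])
      invFun := fun ψ => ⟨fun x => ψ (Quotient.mk _ x), fun x => by
        refine congrArg ψ ?_
        exact Quotient.sound (s := SameCycle.setoid σ) (sameCycle_apply_left.2 (SameCycle.refl _ _))⟩
      left_inv := fun φ => rfl
      right_inv := fun ψ => by
        ext q
        induction q using Quotient.inductionOn
        rfl }
  rw [Nat.card_congr e, Nat.card_fun]
  simp

lemma cycleCount_of_equiv {α β : Type*} [Fintype α] [DecidableEq α] [Fintype β] [DecidableEq β]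
    (e : α ≃ β) (σ : Perm α) (τ : Perm β) (h : ∀ x, e (σ x) = τ (e x)) :
    cycleCount σ = cycleCount τ := by
  apply Nat.pow_right_injective (le_refl 2)
  simp only
  rw [← inv_card, ← inv_card]
  refine (Nat.card_congr ((Equiv.arrowCongr e.symm (Equiv.refl _)).subtypeEquiv ?_)).symm
  intro φ
  simp only [arrowCongr_apply, Function.comp, Equiv.refl_apply, Equiv.symm_symm, h]
  exact (e.forall_congr_left.trans (by simp)).symm

lemma cycleCount_conj {α : Type*} [Fintype α] [DecidableEq α] (σ g : Perm α) :
    cycleCount (g * σ * g⁻¹) = cycleCount σ :=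
  (cycleCount_of_equiv g _ _ (by simp)).symm

lemma cycleCount_add {α : Type*} [Fintype α] [DecidableEq α] (p : α → Prop) [DecidablePred p] (σ : Perm α)
    (ρ : Perm {x // p x}) (ρ' : Perm {x // ¬ p x}) (h : ∀ x : {x // p x}, σ x = ρ x)
    (h' : ∀ x : {x // ¬ p x}, σ x = ρ' x) :
    cycleCount σ = cycleCount ρ + cycleCount ρ' := by
  apply Nat.pow_right_injective (le_refl 2)
  simp only
  rw [pow_add, ← inv_card, ← inv_card, ← inv_card, ← Nat.card_prod]
  refine Nat.card_congr
    { toFun := fun φ => (⟨fun x => φ.1 x, fun x => by simp only; rw [← h, φ.2]⟩, ⟨fun x => φ.1 x, fun x => by simp only; rw [← h', φ.2]⟩)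
      invFun := fun ψ => ⟨fun x => if hx : p x then ψ.1.1 ⟨x, hx⟩ else ψ.2.1 ⟨x, hx⟩, fun x => by
        by_cases hx : p x
        · have := h ⟨x, hx⟩
          simp only at this
          rw [this]
          simp only [Subtype.prop, dif_pos, hx]
          exact ψ.1.2 ⟨x, hx⟩
        · have := h' ⟨x, hx⟩
          simp only at this
          rw [this]
          have h2 := (ρ' ⟨x, hx⟩).2
          simp only [h2, dif_neg, hx, not_false_eq_true]
          exact ψ.2.2 ⟨x, hx⟩⟩
      left_inv := fun φ => by ext x; simp
      right_inv := fun ψ => by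
        ext x
        · simp [x.2]
        · have := x.2
          simp [this] }

lemma cycleCount_swap_mul {α : Type*} [Fintype α] [DecidableEq α] (S : Finset α) (τ : Perm α)
    (hτ : ∀ x, τ x ∈ S ↔ x ∈ S) (a b : α) (ha : a ∉ S) (hb : b ∈ S) :
    cycleCount (swap a b * τ) + 1 = cycleCount τ := by
  apply Nat.pow_right_injective (le_refl 2)
  simp only
  rw [pow_succ, ← inv_card, ← inv_card]
  have hab : a ≠ b := fun h => ha (h ▸ hb)
  have key : ∀ ψ : α → ZMod 2, (∀ x, ψ ((swap a b * τ) x) = ψ x) → ψ a = ψ b := by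
    intro ψ hψ
    have h1 : ∑ y ∈ S, ψ (swap a b (τ y)) = ∑ y ∈ S, ψ (swap a b y) :=
      Finset.sum_equiv τ (fun x => (hτ x).symm) (fun x _ => rfl)
    have h2 : ∑ y ∈ S, ψ (swap a b (τ y)) = ∑ y ∈ S, ψ y := Finset.sum_congr rfl (fun x _ => hψ x)
    rw [h2, ← Finset.add_sum_erase _ _ hb, ← Finset.add_sum_erase _ (fun y => ψ (swap a b y)) hb] at h1
    have h3 : ∑ y ∈ S.erase b, ψ (swap a b y) = ∑ y ∈ S.erase b, ψ y := by
      refine Finset.sum_congr rfl fun x hx => ?_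
      rw [swap_apply_of_ne_of_ne]
      · rintro rfl; exact ha (Finset.mem_of_mem_erase hx)
      · exact Finset.ne_of_mem_erase hx
    rw [h3] at h1
    simpa using (add_right_cancel h1).symm
  have key2 : ∀ ψ : α → ZMod 2, ψ a = ψ b → ∀ x, ψ (swap a b x) = ψ x := by
    intro ψ h x
    rw [swap_apply_def]
    split_ifs with h1 h2
    · rw [h1, h]
    · rw [h2, h]
    · rfl
  have h2 : Nat.card (ZMod 2) = 2 := by simp
  have h4 : ∀ k, k * 2 = k * Nat.card (ZMod 2) := fun k => by rw [h2]
  rw [h4, ← Nat.card_prod]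
  have f1 : ∀ φ : α → ZMod 2, (∀ x, φ (τ x) = φ x) →
      ∀ x, (fun x => φ x + if x ∈ S then φ a - φ b else 0) ((swap a b * τ) x) =
        (fun x => φ x + if x ∈ S then φ a - φ b else 0) x := by
    intro φ hφ x
    have := key2 (fun x => φ x + if x ∈ S then φ a - φ b else 0) (by simp [ha, hb]) (τ x)
    rw [Perm.mul_apply]
    refine this.trans ?_
    simp [hτ, hφ]
  have f2 : ∀ (ψ : α → ZMod 2) (d : ZMod 2), (∀ x, ψ ((swap a b * τ) x) = ψ x) →
      ∀ x, (fun x => ψ x - if x ∈ S then d else 0) (τ x) = (fun x => ψ x - if x ∈ S then d else 0) x := by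
    intro ψ d hψ x
    have := key2 ψ (key _ hψ)
    have h3 := hψ x
    rw [Perm.mul_apply, this] at h3
    simp [hτ, h3]
  let e : {φ : α → ZMod 2 // ∀ x, φ (τ x) = φ x} ≃
      {φ : α → ZMod 2 // ∀ x, φ ((swap a b * τ) x) = φ x} × ZMod 2 :=
    { toFun := fun φ => (⟨fun x => φ.1 x + if x ∈ S then φ.1 a - φ.1 b else 0, f1 φ.1 φ.2⟩, φ.1 a - φ.1 b)
      invFun := fun ψ => ⟨fun x => ψ.1.1 x - if x ∈ S then ψ.2 else 0, f2 ψ.1.1 ψ.2 ψ.1.2⟩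
      left_inv := fun φ => by ext x; simp
      right_inv := fun ψ => by
        have := (key _ ψ.1.2)
        ext x
        · simp [ha, hb, this]
        · simp [ha, hb, this] }
  exact (Nat.card_congr e).symm


lemma trans_iff {α : Type*} [Fintype α] [DecidableEq α] [Nonempty α] (σ : Perm α) :
    cycleCount σ = 1 ↔ ∀ x y, σ.SameCycle x y := by
  rw [cycleCount_eq, Nat.card_eq_one_iff_unique]
  constructor
  · rintro ⟨h, -⟩ x y
    exact Quotient.exact (s := SameCycle.setoid σ) (Subsingleton.elim _ _)
  · intro h
    refine ⟨⟨fun a b => ?_⟩, ⟨Quotient.mk _ (Classical.arbitrary α)⟩⟩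
    induction a using Quotient.inductionOn
    induction b using Quotient.inductionOn
    exact Quotient.sound (s := SameCycle.setoid σ) (h _ _)

lemma sum_fix {α : Type*} [Fintype α] [DecidableEq α] (σ : Perm α) :
    σ.cycleType.sum + (Finset.univ.filter fun x => σ x = x).card = Fintype.card α := by
  rw [sum_cycleType]
  have : σ.support = Finset.univ.filter fun x => ¬ σ x = x := by ext; simp
  rw [this, add_comm, Finset.card_filter_add_card_filter_not, Finset.card_univ]

lemma mem_fullCycles (n : ℕ) (hn : 1 ≤ n) (τ : Perm (Fin n)) :
    τ ∈ fullCycles n ↔ ∀ x y, τ.SameCycle x y := by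
  have : Nonempty (Fin n) := ⟨⟨0, hn⟩⟩
  rw [← trans_iff, fullCycles, Finset.mem_filter]
  simp only [Finset.mem_univ, true_and]
  have hc : cycleCount τ = (fullCycleType τ).card := by simp [cycleCount, fullCycleType]
  constructor
  · intro h
    rw [hc, h]; rfl
  · intro h
    rw [hc] at h
    obtain ⟨m, hm⟩ := Multiset.card_eq_one.1 h
    have : (fullCycleType τ).sum = n := by
      rw [fullCycleType, Multiset.sum_add, Multiset.sum_replicate]
      simpa using sum_fix τ
    rw [hm] at this ⊢
    simp at this
    rw [this]

lemma sign_of_trans {α : Type*} [Fintype α] [DecidableEq α] [Nonempty α] (σ : Perm α)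
    (h : ∀ x y, σ.SameCycle x y) : sign σ = -(-1) ^ (Fintype.card α) := by
  have h1 := (trans_iff σ).2 h
  have h2 := sum_fix σ
  rw [cycleCount] at h1
  rw [sign_of_cycleType, ← h2]
  rcases Nat.eq_zero_or_pos (Multiset.card σ.cycleType) with h0 | h0
  · have h3 := Multiset.card_eq_zero.1 h0
    rw [h0, zero_add] at h1
    rw [h0, h1, h3]
    simp
  · have h4 : Multiset.card σ.cycleType = 1 := by omega
    have h5 : (Finset.univ.filter fun x => σ x = x).card = 0 := by omega
    rw [h4, h5, pow_succ]
    simp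

/-- signed indicator of preserving `S`. -/
noncomputable def sgS {α : Type*} [Fintype α] [DecidableEq α] (S : Finset α) (τ : Perm α) : ℤ :=
  if h : ∀ x, τ x ∈ S ↔ x ∈ S then ((sign (τ.subtypePerm h) : ℤˣ) : ℤ) else 0

section sg
variable {α : Type*} [Fintype α] [DecidableEq α]

lemma sgS_pos (S : Finset α) (τ : Perm α) (h : ∀ x, τ x ∈ S ↔ x ∈ S) :
    sgS S τ = ((sign (τ.subtypePerm h) : ℤˣ) : ℤ) := dif_pos h

lemma sgS_neg (S : Finset α) (τ : Perm α) (h : ¬ ∀ x, τ x ∈ S ↔ x ∈ S) : sgS S τ = 0 := dif_neg h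

lemma sgS_mul (S : Finset α) (u τ : Perm α) (hu : ∀ x, u x ∈ S ↔ x ∈ S) :
    sgS S (u * τ) = sgS S u * sgS S τ := by
  by_cases h : ∀ x, τ x ∈ S ↔ x ∈ S
  · have h' : ∀ x, (u * τ) x ∈ S ↔ x ∈ S := fun x => (hu _).trans (h x)
    rw [sgS_pos S _ h, sgS_pos S _ h', sgS_pos S _ hu, ← Units.val_mul, ← Perm.sign_mul]
    rfl
  · rw [sgS_neg S τ h, sgS_neg, mul_zero]
    intro h'
    exact h fun x => ((hu _).symm.trans (h' x))

lemma sgS_mul' (S : Finset α) (u τ : Perm α) (hu : ∀ x, u x ∈ S ↔ x ∈ S) :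
    sgS S (τ * u) = sgS S τ * sgS S u := by
  by_cases h : ∀ x, τ x ∈ S ↔ x ∈ S
  · exact sgS_mul S τ u h
  · rw [sgS_neg S τ h, sgS_neg, zero_mul]
    intro h'
    apply h
    intro x
    have h1 := h' (u⁻¹ x)
    have h2 := hu (u⁻¹ x)
    simp only [Perm.mul_apply, Perm.coe_inv, Equiv.apply_symm_apply] at h1 h2
    exact h1.trans h2.symm

lemma sgS_sq (S : Finset α) (u : Perm α) (hu : ∀ x, u x ∈ S ↔ x ∈ S) : sgS S u * sgS S u = 1 := by
  rw [sgS_pos S _ hu, ← Units.val_mul, Int.units_mul_self, Units.val_one]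

lemma sgS_swap_out (S : Finset α) (a b : α) (ha : a ∉ S) (hb : b ∉ S) :
    (∀ x, swap a b x ∈ S ↔ x ∈ S) ∧ sgS S (swap a b) = 1 := by
  have h0 : ∀ x ∈ S, swap a b x = x := fun x hx =>
    swap_apply_of_ne_of_ne (fun h => ha (h ▸ hx)) (fun h => hb (h ▸ hx))
  have h : ∀ x, swap a b x ∈ S ↔ x ∈ S := by
    intro x
    constructor
    · intro hx
      have := h0 _ hx
      rw [swap_apply_self] at this
      rwa [this]
    · intro hx; rwa [h0 x hx]
  refine ⟨h, ?_⟩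
  have : (swap a b).subtypePerm h = 1 := by
    ext x
    exact h0 x x.2
  rw [sgS_pos S _ h, this]
  simp

lemma sgS_swap_in (S : Finset α) (a b : α) (hab : a ≠ b) (ha : a ∈ S) (hb : b ∈ S) :
    (∀ x, swap a b x ∈ S ↔ x ∈ S) ∧ sgS S (swap a b) = -1 := by
  have h : ∀ x, swap a b x ∈ S ↔ x ∈ S := by
    intro x
    rw [swap_apply_def]
    split_ifs with h1 h2
    · simp [h1, ha, hb]
    · simp [h2, ha, hb]
    · rfl
  refine ⟨h, ?_⟩
  have h2 : sign ((swap a b).subtypePerm h) = sign (swap a b) := by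
    rw [← sign_ofSubtype ((swap a b).subtypePerm h), ofSubtype_subtypePerm]
    intro x hx
    by_contra hxS
    exact hx (swap_apply_of_ne_of_ne (fun h => hxS (h ▸ ha)) (fun h => hxS (h ▸ hb)))
  rw [sgS_pos S _ h, h2, sign_swap hab]
  simp

lemma sgS_union (S Z : Finset α) (hd : Disjoint S Z) (τ : Perm α) (hS : ∀ x, τ x ∈ S ↔ x ∈ S)
    (hZ : ∀ x, τ x ∈ Z ↔ x ∈ Z) : sgS (S ∪ Z) τ = sgS S τ * sgS Z τ := by
  have hU : ∀ x, τ x ∈ S ∪ Z ↔ x ∈ S ∪ Z := by intro x; simp [hS, hZ]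
  rw [sgS_pos S _ hS, sgS_pos Z _ hZ, sgS_pos _ _ hU, ← Units.val_mul, ← sign_ofSubtype (τ.subtypePerm hS),
    ← sign_ofSubtype (τ.subtypePerm hZ), ← sign_ofSubtype (τ.subtypePerm hU), ← Perm.sign_mul]
  congr 2
  ext x
  rw [Perm.mul_apply]
  by_cases h1 : x ∈ Z
  · have h2 : τ x ∉ S := fun h => Finset.disjoint_left.1 hd h ((hZ x).2 h1)
    rw [ofSubtype_apply_of_mem (p := (· ∈ Z)) _ h1, ofSubtype_apply_of_mem (p := (· ∈ S ∪ Z)) _ (by simp [h1])]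
    simp only [subtypePerm_apply]
    rw [ofSubtype_apply_of_not_mem (p := (· ∈ S)) _ h2]
  · rw [ofSubtype_apply_of_not_mem (p := (· ∈ Z)) _ h1]
    by_cases h3 : x ∈ S
    · rw [ofSubtype_apply_of_mem (p := (· ∈ S)) _ h3, ofSubtype_apply_of_mem (p := (· ∈ S ∪ Z)) _ (by simp [h3])]
      simp
    · rw [ofSubtype_apply_of_not_mem (p := (· ∈ S)) _ h3, ofSubtype_apply_of_not_mem (p := (· ∈ S ∪ Z)) _ (by simp [h1, h3])]

lemma sgS_empty (τ : Perm α) : sgS ∅ τ = 1 := by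
  rw [sgS_pos _ _ (by simp)]
  have : τ.subtypePerm (p := (· ∈ (∅ : Finset α))) (by simp) = 1 := by
    ext x; exact absurd x.2 (Finset.notMem_empty _)
  rw [this]; simp

lemma sgS_trans (Z : Finset α) (hne : Z.Nonempty) (τ : Perm α) (hZ : ∀ x, τ x ∈ Z ↔ x ∈ Z)
    (h : ∀ x ∈ Z, ∀ y ∈ Z, τ.SameCycle x y) : sgS Z τ = -(-1) ^ Z.card := by
  have : Nonempty {x // x ∈ Z} := ⟨⟨hne.choose, hne.choose_spec⟩⟩
  rw [sgS_pos Z _ hZ, sign_of_trans]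
  · simp
  · intro x y
    rw [sameCycle_subtypePerm]
    exact h x x.2 y y.2

lemma indicator (p : α) (τ : Perm α) :
    ∑ S ∈ (Finset.univ.erase p).powerset, (-1 : ℤ) ^ S.card * sgS S τ =
      if ∀ x y, τ.SameCycle x y then 1 else 0 := by
  have inv_of : ∀ S : Finset α, (∀ x, τ x ∈ S ↔ x ∈ S) → ∀ x y, τ.SameCycle x y → (x ∈ S ↔ y ∈ S) := by
    intro S hS x y hxy
    obtain ⟨i, rfl⟩ := hxy.exists_nat_pow_eq
    clear hxy
    induction i with
    | zero => simp
    | succ k ih => rw [pow_succ', Perm.mul_apply, hS, ih]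
  split_ifs with h
  · rw [Finset.sum_eq_single ∅]
    · simp [sgS_empty]
    · intro S hS hne
      rw [sgS_neg, mul_zero]
      intro hS'
      obtain ⟨x, hx⟩ := Finset.nonempty_iff_ne_empty.2 hne
      have := (inv_of S hS' x p (h x p)).1 hx
      rw [Finset.mem_powerset] at hS
      simpa using hS this
    · simp
  · have hq : ∃ q, ¬ τ.SameCycle p q := by
      by_contra! hq
      exact h fun x y => (hq x).symm.trans (hq y)
    obtain ⟨q, hq⟩ := hq
    let Z : Finset α := Finset.univ.filter fun x => τ.SameCycle q x
    have memZ : ∀ x, x ∈ Z ↔ τ.SameCycle q x := by intro x; simp [Z]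
    have hZ : ∀ x, τ x ∈ Z ↔ x ∈ Z := by intro x; rw [memZ, memZ, sameCycle_apply_right]
    have hqZ : q ∈ Z := (memZ q).2 (SameCycle.refl _ _)
    have hpZ : p ∉ Z := fun h => hq ((memZ p).1 h).symm
    have hsZ : sgS Z τ = -(-1) ^ Z.card := sgS_trans Z ⟨q, hqZ⟩ τ hZ
      fun x hx y hy => ((memZ x).1 hx).symm.trans ((memZ y).1 hy)
    have main : ∀ S : Finset α, (∀ x, τ x ∈ S ↔ x ∈ S) → Disjoint S Z →
        (-1 : ℤ) ^ S.card * sgS S τ + (-1 : ℤ) ^ (S ∪ Z).card * sgS (S ∪ Z) τ = 0 := by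
      intro S hS hd
      rw [sgS_union S Z hd τ hS hZ, Finset.card_union_of_disjoint hd, hsZ, pow_add]
      have : ((-1 : ℤ) ^ Z.card) * (-1) ^ Z.card = 1 := by rw [← mul_pow]; simp
      linear_combination (-(-1) ^ S.card * sgS S τ) * this
    rw [← Finset.sum_filter_of_ne (p := fun S => ∀ x, τ x ∈ S ↔ x ∈ S)]
    swap
    · intro S _ hne
      by_contra hS
      rw [sgS_neg _ _ hS, mul_zero] at hne
      exact hne rfl
    have dich : ∀ S : Finset α, (∀ x, τ x ∈ S ↔ x ∈ S) → (q ∈ S → Z ⊆ S) ∧ (q ∉ S → Disjoint S Z) := by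
      intro S hS
      refine ⟨fun hqS x hx => (inv_of S hS q x ((memZ x).1 hx)).1 hqS, fun hqS => ?_⟩
      rw [Finset.disjoint_left]
      intro x hx hxZ
      exact hqS ((inv_of S hS q x ((memZ x).1 hxZ)).2 hx)
    refine Finset.sum_involution (fun S _ => if q ∈ S then S \ Z else S ∪ Z) ?_ ?_ ?_ ?_
    · intro S hS
      rw [Finset.mem_filter] at hS
      by_cases hqS : q ∈ S
      · simp only [hqS, if_true]
        have h1 := main (S \ Z) (by intro x; simp [hS.2, hZ]) Finset.sdiff_disjoint
        rw [Finset.sdiff_union_of_subset ((dich S hS.2).1 hqS)] at h1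
        rw [add_comm]; exact h1
      · simp only [hqS, if_false]
        exact main S hS.2 ((dich S hS.2).2 hqS)
    · intro S hS _ h
      by_cases hqS : q ∈ S
      · simp only [hqS, if_true] at h
        rw [← h] at hqS
        simp [hqZ] at hqS
      · simp only [hqS, if_false] at h
        apply hqS
        rw [← h]
        simp [hqZ]
    · intro S hS
      rw [Finset.mem_filter, Finset.mem_powerset] at hS ⊢
      by_cases hqS : q ∈ S
      · simp only [hqS, if_true]
        exact ⟨Finset.sdiff_subset.trans hS.1, by intro x; simp [hS.2, hZ]⟩
      · simp only [hqS, if_false]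
        refine ⟨Finset.union_subset hS.1 ?_, by intro x; simp [hS.2, hZ]⟩
        intro x hx
        rw [Finset.mem_erase]
        exact ⟨fun h => hpZ (h ▸ hx), Finset.mem_univ _⟩
    · intro S hS
      rw [Finset.mem_filter] at hS
      by_cases hqS : q ∈ S
      · simp only [hqS, if_true]
        have : q ∉ S \ Z := by simp [hqZ]
        simp only [this, if_false]
        exact Finset.sdiff_union_of_subset ((dich S hS.2).1 hqS)
      · simp only [hqS, if_false]
        have : q ∈ S ∪ Z := by simp [hqZ]
        simp only [this, if_true]
        exact Finset.union_sdiff_cancel_right ((dich S hS.2).2 hqS)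

end sg


lemma sum_fin {R : Type*} [CommRing R] (y : R) (χ : ℤˣ →* R) (n : ℕ) :
    ∑ π : Perm (Fin n), χ (sign π) * y ^ cycleCount π = ∏ i ∈ Finset.range n, (y + χ (-1) * i) := by
  induction n with
  | zero =>
    have : cycleCount (1 : Perm (Fin 0)) = 0 := by simp [cycleCount]
    simp [this]
  | succ n ih =>
    have h0 : ∀ e : Perm (Fin n), cycleCount (decomposeFin.symm (0, e)) = cycleCount e + 1 := by
      intro e
      apply Nat.pow_right_injective (le_refl 2)
      simp only
      have h2 : ∀ k, k * 2 = k * Nat.card (ZMod 2) := fun k => by simp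
      rw [pow_succ, ← inv_card, ← inv_card, h2, ← Nat.card_prod]
      have f1 : ∀ φ : Fin (n+1) → ZMod 2, (∀ x, φ (decomposeFin.symm (0, e) x) = φ x) →
          ∀ x, (fun x : Fin n => φ x.succ) (e x) = (fun x : Fin n => φ x.succ) x := by
        intro φ h x
        have := h x.succ
        simpa using this
      have f2 : ∀ (ψ : Fin n → ZMod 2) (d : ZMod 2), (∀ x, ψ (e x) = ψ x) →
          ∀ x, (Fin.cons d ψ : Fin (n+1) → ZMod 2) (decomposeFin.symm (0, e) x) =
            (Fin.cons d ψ : Fin (n+1) → ZMod 2) x := by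
        intro ψ d h x
        refine Fin.cases ?_ (fun j => ?_) x
        · simp
        · simp [h]
      let E : {φ : Fin (n+1) → ZMod 2 // ∀ x, φ (decomposeFin.symm (0, e) x) = φ x} ≃
          {φ : Fin n → ZMod 2 // ∀ x, φ (e x) = φ x} × ZMod 2 :=
        { toFun := fun φ => (⟨fun x => φ.1 x.succ, f1 φ.1 φ.2⟩, φ.1 0)
          invFun := fun ψ => ⟨Fin.cons ψ.2 ψ.1.1, f2 ψ.1.1 ψ.2 ψ.1.2⟩
          left_inv := fun φ => by
            ext x
            refine Fin.cases ?_ (fun j => ?_) x <;> simp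
          right_inv := fun ψ => by ext x <;> simp }
      exact Nat.card_congr E
    have hs : ∀ (i : Fin n) (e : Perm (Fin n)), cycleCount (decomposeFin.symm (i.succ, e)) = cycleCount e := by
      intro i e
      have h1 : decomposeFin.symm (i.succ, e) = swap i.succ 0 * decomposeFin.symm (0, e) := by
        ext x
        refine Fin.cases ?_ (fun j => ?_) x
        · simp
        · simp [swap_comm]
      have h2 := cycleCount_swap_mul {0} (decomposeFin.symm (0, e)) (by
        intro x
        refine Fin.cases ?_ (fun j => ?_) x <;> simp) i.succ 0 (by simp) (by simp)
      rw [← h1, h0] at h2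
      omega
    rw [← Equiv.sum_comp (decomposeFin (n := n)).symm, Fintype.sum_prod_type, Fin.sum_univ_succ,
      Finset.prod_range_succ, ← ih]
    have e1 : ∀ i : Fin n, ∑ e : Perm (Fin n), χ (sign (decomposeFin.symm (i.succ, e))) *
        y ^ cycleCount (decomposeFin.symm (i.succ, e)) =
        χ (-1) * ∑ e : Perm (Fin n), χ (sign e) * y ^ cycleCount e := by
      intro i
      rw [Finset.mul_sum]
      refine Finset.sum_congr rfl fun e _ => ?_
      rw [hs, decomposeFin.symm_sign, if_neg (Fin.succ_ne_zero i), map_mul]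
      ring
    rw [Finset.sum_congr rfl (fun i _ => e1 i)]
    have e0 : ∑ e : Perm (Fin n), χ (sign (decomposeFin.symm (0, e))) *
        y ^ cycleCount (decomposeFin.symm (0, e)) =
        y * ∑ e : Perm (Fin n), χ (sign e) * y ^ cycleCount e := by
      rw [Finset.mul_sum]
      refine Finset.sum_congr rfl fun e _ => ?_
      rw [h0, decomposeFin.symm_sign, if_pos rfl, one_mul]
      ring
    rw [e0]
    simp
    ring

lemma sum_type {R : Type*} [CommRing R] (y : R) (χ : ℤˣ →* R) (α : Type*) [Fintype α] [DecidableEq α] :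
    ∑ π : Perm α, χ (sign π) * y ^ cycleCount π =
      ∏ i ∈ Finset.range (Fintype.card α), (y + χ (-1) * i) := by
  rw [← sum_fin]
  refine Fintype.sum_equiv (Fintype.equivFin α).permCongr _ _ fun π => ?_
  rw [sign_permCongr, cycleCount_of_equiv (Fintype.equivFin α) π ((Fintype.equivFin α).permCongr π)]
  intro x
  simp [Equiv.permCongr_apply]

section sums
variable {α : Type*} [Fintype α] [DecidableEq α] {R : Type*} [CommRing R]

lemma sum_sgS (y : R) (S : Finset α) :
    ∑ τ : Perm α, (sgS S τ : R) * y ^ cycleCount τ =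
      (∏ i ∈ Finset.range S.card, (y - i)) * ∏ i ∈ Finset.range (Fintype.card α - S.card), (y + i) := by
  have h1 := sum_type y (((Int.castRingHom R : ℤ →* R)).comp (Units.coeHom ℤ)) {x // x ∈ S}
  have h2 := sum_type y (1 : ℤˣ →* R) {x // ¬ x ∈ S}
  have hc : Fintype.card {x // ¬ x ∈ S} = Fintype.card α - S.card := by
    rw [Fintype.card_subtype_compl]; simp
  rw [hc] at h2
  simp at h1 h2
  simp only [← sub_eq_add_neg] at h1
  rw [← h1, ← h2, Finset.sum_mul_sum, ← Finset.sum_product', Finset.univ_product_univ]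
  symm
  refine Finset.sum_of_injOn (fun x : Perm {x // x ∈ S} × Perm {x // ¬ x ∈ S} => Perm.subtypeCongr x.1 x.2) ?_ ?_ ?_ ?_
  · exact (subtypeCongrHom_injective (· ∈ S)).injOn
  · intro x _; simp
  · intro τ _ hτ
    rw [sgS_neg, Int.cast_zero, zero_mul]
    intro h
    apply hτ
    refine ⟨(τ.subtypePerm h, τ.subtypePerm (fun x => not_congr (h x))), by simp, ?_⟩
    ext x
    by_cases hx : x ∈ S
    · simp [Perm.subtypeCongr.left_apply, hx]
    · simp [Perm.subtypeCongr.right_apply, hx]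
  · rintro ⟨ρ, ρ'⟩ _
    have hl : ∀ x : {x // x ∈ S}, Perm.subtypeCongr ρ ρ' x = ρ x := fun x => by simp
    have hr : ∀ x : {x // ¬ x ∈ S}, Perm.subtypeCongr ρ ρ' x = ρ' x := fun x => by simp
    have hp : ∀ x, Perm.subtypeCongr ρ ρ' x ∈ S ↔ x ∈ S := by
      intro x
      by_cases hx : x ∈ S
      · have := hl ⟨x, hx⟩
        simp only at this
        rw [this]; simp [hx]
      · have := hr ⟨x, hx⟩
        simp only at this
        rw [this]
        have h2 := (ρ' ⟨x, hx⟩).2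
        simp [hx, h2]
    have hρ : (Perm.subtypeCongr ρ ρ').subtypePerm hp = ρ := by
      ext x
      exact hl x
    simp only
    rw [sgS_pos _ _ hp, hρ, cycleCount_add (· ∈ S) _ ρ ρ' hl hr, pow_add, ← mul_assoc]
    congr!

lemma H_one (y : R) (S : Finset α) (c : Perm α) (a b : α) (ha : a ∉ S) (hb : b ∈ S)
    (hv : ∀ x, (swap a b * c) x ∈ S ↔ x ∈ S) :
    y * ∑ τ : Perm α, (sgS S τ : R) * y ^ cycleCount (c * τ) = (sgS S (swap a b * c) : R) *
      ((∏ i ∈ Finset.range S.card, (y - i)) * ∏ i ∈ Finset.range (Fintype.card α - S.card), (y + i)) := by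
  rw [← sum_sgS, Finset.mul_sum, Finset.mul_sum]
  set v := swap a b * c with hvd
  refine Fintype.sum_equiv (Equiv.mulLeft v) _ _ fun τ => ?_
  simp only [Equiv.coe_mulLeft]
  by_cases h : ∀ x, τ x ∈ S ↔ x ∈ S
  · have h1 := cycleCount_swap_mul S (v * τ) (fun x => (hv _).trans (h x)) a b ha hb
    have h2 : swap a b * (v * τ) = c * τ := by
      rw [hvd, ← mul_assoc, ← mul_assoc, swap_mul_self, one_mul]
    rw [h2] at h1
    rw [← h1, sgS_mul S v τ hv, pow_succ]
    have h3 : (sgS S v : R) * (sgS S v : R) = 1 := by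
      rw [← Int.cast_mul, sgS_sq S v hv, Int.cast_one]
    push_cast
    linear_combination (- (sgS S τ : R) * y ^ cycleCount (c * τ) * y) * h3
  · rw [sgS_mul S v τ hv, sgS_neg S τ h]
    simp

lemma H_two (y : R) (S : Finset α) (c : Perm α) (a b : α) (hab : a ≠ b) (ha : a ∈ S) (hb : b ∈ S)
    (hca : c a ∉ S) (hcb : c b ∉ S) :
    ∑ τ : Perm α, (sgS S τ : R) * y ^ cycleCount (c * τ) = 0 := by
  obtain ⟨h1, h2⟩ := sgS_swap_in S a b hab ha hb
  obtain ⟨h3, h4⟩ := sgS_swap_out S (c a) (c b) hca hcb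
  have key : ∀ τ, sgS S (swap a b * τ * swap (c a) (c b)) = - sgS S τ := by
    intro τ
    rw [sgS_mul' _ _ _ h3, sgS_mul _ _ _ h1, h2, h4]; ring
  refine Finset.sum_involution (fun τ _ => swap a b * τ * swap (c a) (c b)) ?_ ?_ ?_ ?_
  · intro τ _
    have : c * (swap a b * τ * swap (c a) (c b)) =
        swap (c a) (c b) * (c * τ) * (swap (c a) (c b))⁻¹ := by
      rw [swap_inv, mul_assoc (swap a b), ← mul_assoc c, mul_swap_eq_swap_mul]
      simp only [mul_assoc]
    rw [key, this, cycleCount_conj]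
    push_cast; ring
  · intro τ _ hne h
    have h5 := key τ
    rw [h] at h5
    have : sgS S τ = 0 := by omega
    rw [this] at hne
    simp at hne
  · intro τ _; simp
  · intro τ _
    simp only [mul_assoc, swap_mul_self, mul_one]
    simp only [← mul_assoc, swap_mul_self, one_mul]

end sums


section alg
variable {R : Type*} [CommRing R]

/-- rising factorial -/
def qq (k : ℕ) (z : R) : R := ∏ i ∈ Finset.range k, (z + i)

lemma qq_diff (k : ℕ) (z : R) : qq (k+1) (z+1) - qq (k+1) z = (k+1) * qq k (z+1) := by
  have h1 : qq (k+1) (z+1) = qq k (z+1) * (z + 1 + k) := by rw [qq, Finset.prod_range_succ, qq]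
  have h2 : qq (k+1) z = qq k (z+1) * z := by
    rw [qq, Finset.prod_range_succ', qq]
    congr 1
    · refine Finset.prod_congr rfl fun i _ => ?_
      push_cast; ring
    · simp
  rw [h1, h2]; ring

lemma fall_eq (k : ℕ) (y : R) : ∏ i ∈ Finset.range (k+1), (y - i) = qq (k+1) (y - k) := by
  rw [qq, ← Finset.prod_range_reflect]
  refine Finset.prod_congr rfl fun i hi => ?_
  rw [Finset.mem_range] at hi
  have : k + 1 - 1 - i = k - i := by omega
  rw [this, Nat.cast_sub (by omega)]
  ring

lemma fall_rise (m r : ℕ) (hr : r ≤ m) (y : R) :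
    (∏ i ∈ Finset.range (r+1), (y - i)) * ∏ i ∈ Finset.range (m - r), (y + i) = y * qq m (y - r) := by
  obtain ⟨d, rfl⟩ := Nat.exists_eq_add_of_le hr
  have h1 : qq (r + d) (y - r) = qq r (y - r) * qq d y := by
    rw [qq, Finset.prod_range_add, qq, qq]
    congr 1
    refine Finset.prod_congr rfl fun i _ => ?_
    push_cast; ring
  have h2 : qq (r + 1) (y - r) = qq r (y-r) * y := by
    rw [qq, Finset.prod_range_succ, qq]; ring
  rw [fall_eq, h1, h2, Nat.add_sub_cancel_left]
  simp only [qq]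
  ring

lemma abel_sum (u : ℕ → R) (m : ℕ) :
    ∑ r ∈ Finset.range m, ((m - r : ℕ) : R) * (u r - u (r+1)) = m * u 0 - ∑ r ∈ Finset.range m, u (r+1) := by
  induction m with
  | zero => simp
  | succ m ih =>
    have h1 : ∑ r ∈ Finset.range (m+1), ((m + 1 - r : ℕ) : R) * (u r - u (r+1)) =
        ∑ r ∈ Finset.range (m+1), ((m - r : ℕ) : R) * (u r - u (r+1)) + ∑ r ∈ Finset.range (m+1), (u r - u (r+1)) := by
      rw [← Finset.sum_add_distrib]
      refine Finset.sum_congr rfl fun r hr => ?_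
      rw [Finset.mem_range] at hr
      have : m + 1 - r = (m - r) + 1 := by omega
      rw [this]; push_cast; ring
    rw [h1, Finset.sum_range_sub', Finset.sum_range_succ, ih, Finset.sum_range_succ _ m]
    simp
    ring

lemma final_alg (m : ℕ) (y P : R)
    (h : y * P = y * (∏ i ∈ Finset.range (m+1), (y + i)) - ∑ r ∈ Finset.range m, ((m - r : ℕ) : R) *
      ((∏ i ∈ Finset.range (r+1), (y - i)) * ∏ i ∈ Finset.range (m - r), (y + i))) :
    y * (((m+1 : ℕ) : R) * ((m + 2 : ℕ) : R) * P) =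
      y * ((∏ i ∈ Finset.range (m+2), (y + i)) - ∏ i ∈ Finset.range (m+2), (y - i)) := by
  have h1 : ∑ r ∈ Finset.range m, ((m - r : ℕ) : R) *
      ((∏ i ∈ Finset.range (r+1), (y - i)) * ∏ i ∈ Finset.range (m - r), (y + i)) =
      y * ∑ r ∈ Finset.range m, ((m - r : ℕ) : R) * qq m (y - r) := by
    rw [Finset.mul_sum]
    refine Finset.sum_congr rfl fun r hr => ?_
    rw [fall_rise m r (Finset.mem_range.1 hr).le]
    ring
  have h2 : ∀ k r : ℕ, ((k + 1 : ℕ) : R) * qq k (y - r) = qq (k+1) (y - r) - qq (k+1) (y - (r + 1 : ℕ)) := by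
    intro k r
    have := qq_diff k (y - (r + 1 : ℕ))
    have e : y - ((r + 1 : ℕ) : R) + 1 = y - r := by push_cast; ring
    rw [e] at this
    rw [this]; push_cast; ring
  have h3 : ((m + 1 : ℕ) : R) * ∑ r ∈ Finset.range m, ((m - r : ℕ) : R) * qq m (y - r) =
      m * qq (m+1) (y - (0 : ℕ)) - ∑ r ∈ Finset.range m, qq (m+1) (y - (r + 1 : ℕ)) := by
    rw [← abel_sum (fun r => qq (m+1) (y - (r : ℕ))), Finset.mul_sum]
    refine Finset.sum_congr rfl fun r _ => ?_
    rw [← h2]; ring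
  have h4 : ((m + 2 : ℕ) : R) * ∑ r ∈ Finset.range (m+1), qq (m+1) (y - r) =
      qq (m+2) (y - (0 : ℕ)) - qq (m+2) (y - (m + 1 : ℕ)) := by
    rw [← Finset.sum_range_sub' (fun r => qq (m+2) (y - (r : ℕ))), Finset.mul_sum]
    exact Finset.sum_congr rfl fun r _ => h2 (m+1) r
  rw [Finset.sum_range_succ'] at h4
  have h5 : ∏ i ∈ Finset.range (m+2), (y + i) = qq (m+2) (y - (0 : ℕ)) := by simp [qq]
  have h6 : ∏ i ∈ Finset.range (m+1), (y + i) = qq (m+1) (y - (0 : ℕ)) := by simp [qq]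
  rw [h5, fall_eq (m+1), ← h4]
  rw [h1, h6] at h
  have hm : ((m + 1 : ℕ) : R) = m + 1 := by push_cast; ring
  linear_combination ((m+1 : ℕ) : R) * ((m + 2 : ℕ) : R) * h - y * ((m + 2 : ℕ) : R) * h3 + y * ((m + 2 : ℕ) : R) * qq (m+1) (y - (0 : ℕ)) * hm

end alg

/-- intervals -/
def II (m s r : ℕ) : Finset (Fin (m+1)) := Finset.univ.filter fun x => s ≤ x.val ∧ x.val ≤ s + r

lemma mem_II (m s r : ℕ) (x : Fin (m+1)) : x ∈ II m s r ↔ s ≤ x.val ∧ x.val ≤ s + r := by simp [II]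

lemma rot_val (m : ℕ) (x : Fin (m+1)) : (finRotate (m+1) x).val = if x.val = m then 0 else x.val + 1 := by
  rw [coe_finRotate]
  congr 1
  rw [Fin.ext_iff]; simp

lemma card_II (m s r : ℕ) (h : s + r ≤ m) : (II m s r).card = r + 1 := by
  have : (II m s r).map Fin.valEmbedding = Finset.Icc s (s + r) := by
    ext x
    simp only [Finset.mem_map, mem_II, Fin.valEmbedding_apply, Finset.mem_Icc]
    constructor
    · rintro ⟨a, ha, rfl⟩; exact ha
    · intro hx; exact ⟨⟨x, by omega⟩, hx, rfl⟩
  rw [← Finset.card_map Fin.valEmbedding, this, Nat.card_Icc]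
  omega

lemma classify (m : ℕ) (S : Finset (Fin (m+1))) (h0 : 0 ∉ S) (hne : S.Nonempty)
    (hu : ∀ a ∈ S, ∀ b ∈ S, finRotate (m+1) a ∉ S → finRotate (m+1) b ∉ S → a = b) :
    ∃ s r, s + r < m ∧ S = II m (s+1) r := by
  set s := S.min' hne with hs
  set M := S.max' hne with hM
  have hsS : s ∈ S := Finset.min'_mem _ _
  have hMS : M ∈ S := Finset.max'_mem _ _
  have hsM : s.val ≤ M.val := Finset.min'_le _ _ hMS
  have hs0 : s.val ≠ 0 := fun h => h0 (by
    have : s = 0 := Fin.ext h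
    rwa [this] at hsS)
  have hMend : finRotate (m+1) M ∉ S := by
    intro h
    have h1 : (finRotate (m+1) M).val ≤ M.val := Finset.le_max' _ _ h
    rw [rot_val] at h1
    split_ifs at h1 with h2
    · apply h0
      have : finRotate (m+1) M = 0 := by
        apply Fin.ext; rw [rot_val, if_pos h2]; rfl
      rwa [this] at h
    · omega
  have key : ∀ k, ∀ h : s.val + k ≤ M.val, (⟨s.val + k, by omega⟩ : Fin (m+1)) ∈ S := by
    intro k
    induction k with
    | zero => intro h; exact hsS
    | succ k ih =>
      intro h
      have h1 := ih (by omega)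
      by_contra h2
      have h3 : finRotate (m+1) (⟨s.val + k, by omega⟩ : Fin (m+1)) = ⟨s.val + (k+1), by omega⟩ := by
        apply Fin.ext
        rw [rot_val]
        simp only
        rw [if_neg (by omega)]; omega
      have h4 := hu _ h1 _ hMS (by rw [h3]; exact h2) hMend
      have h5 := congrArg Fin.val h4
      simp only at h5
      omega
  refine ⟨s.val - 1, M.val - s.val, by omega, ?_⟩
  ext x
  rw [mem_II]
  constructor
  · intro hx
    have h1 : s.val ≤ x.val := Finset.min'_le _ _ hx
    have h2 : x.val ≤ M.val := Finset.le_max' _ _ hx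
    omega
  · intro hx
    have h1 := key (x.val - s.val) (by omega)
    have h2 : (⟨s.val + (x.val - s.val), by omega⟩ : Fin (m+1)) = x := by
      apply Fin.ext; simp only; omega
    rwa [h2] at h1

lemma swap_rot (m s r : ℕ) (h : s + r < m) :
    ∃ a b : Fin (m+1), a ∉ II m (s+1) r ∧ b ∈ II m (s+1) r ∧
      (∀ x, (swap a b * finRotate (m+1)) x ∈ II m (s+1) r ↔ x ∈ II m (s+1) r) ∧
      sgS (II m (s+1) r) (swap a b * finRotate (m+1)) = -(-1) ^ (r+1) := by
  let z : Fin (m+1) := ⟨s + 1 + r, by omega⟩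
  let b : Fin (m+1) := ⟨s + 1, by omega⟩
  have hzv : z.val = s + 1 + r := rfl
  have hbv : b.val = s + 1 := rfl
  have hav := rot_val m z
  set a := finRotate (m+1) z with ha
  have ha' : a ∉ II m (s+1) r := by
    rw [mem_II, hav]; split_ifs <;> omega
  have hb' : b ∈ II m (s+1) r := by rw [mem_II]; omega
  have hab : a ≠ b := fun h => ha' (h ▸ hb')
  have hin : ∀ x : Fin (m+1), s + 1 ≤ x.val → x.val < s + 1 + r →
      ((swap a b * finRotate (m+1)) x).val = x.val + 1 := by
    intro x h1 h2
    have h3 := rot_val m x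
    rw [if_neg (by omega)] at h3
    rw [Perm.mul_apply, swap_apply_of_ne_of_ne, h3]
    · intro h4
      have := (finRotate (m+1)).injective h4
      rw [this] at h2; omega
    · intro h4
      rw [h4] at h3; omega
  have hz : (swap a b * finRotate (m+1)) z = b := by
    rw [Perm.mul_apply, ← ha, swap_apply_left]
  have hpres : ∀ x, x ∈ II m (s+1) r → (swap a b * finRotate (m+1)) x ∈ II m (s+1) r := by
    intro x hx
    by_cases hxz : x = z
    · rw [hxz, hz]; exact hb'
    · rw [mem_II] at hx ⊢
      have : x.val ≠ z.val := fun h => hxz (Fin.ext h)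
      rw [hin x (by omega) (by omega)]
      omega
  have hiff : ∀ x, (swap a b * finRotate (m+1)) x ∈ II m (s+1) r ↔ x ∈ II m (s+1) r := by
    intro x
    refine ⟨fun hx => ?_, hpres x⟩
    have himg : (II m (s+1) r).image (swap a b * finRotate (m+1)) = II m (s+1) r := by
      apply Finset.eq_of_subset_of_card_le
      · intro y hy
        obtain ⟨w, hw, rfl⟩ := Finset.mem_image.1 hy
        exact hpres w hw
      · rw [Finset.card_image_of_injective _ (Equiv.injective _)]
    rw [← himg] at hx
    obtain ⟨w, hw, hwx⟩ := Finset.mem_image.1 hx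
    rwa [← (Equiv.injective _) hwx]
  refine ⟨a, b, ha', hb', hiff, ?_⟩
  rw [sgS_trans _ ⟨b, hb'⟩ _ hiff, card_II _ _ _ (by omega)]
  have hk : ∀ k, k ≤ r → (((swap a b * finRotate (m+1)) ^ k) b).val = s + 1 + k := by
    intro k
    induction k with
    | zero => intro _; simp [hbv]
    | succ k ih =>
      intro hk
      have := ih (by omega)
      rw [pow_succ', Perm.mul_apply, hin _ (by omega) (by omega), this]
      omega
  have hsc : ∀ x ∈ II m (s+1) r, (swap a b * finRotate (m+1)).SameCycle b x := by
    intro x hx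
    rw [mem_II] at hx
    refine ⟨((x.val - (s+1) : ℕ) : ℤ), ?_⟩
    rw [zpow_natCast]
    apply Fin.ext
    rw [hk _ (by omega)]; omega
  intro x hx y hy
  exact (hsc x hx).symm.trans (hsc y hy)

lemma main_sum {R : Type*} [CommRing R] (m : ℕ) (y : R) :
    y * ∑ τ ∈ fullCycles (m+1), y ^ cycleCount (finRotate (m+1) * τ) =
      y * (∏ i ∈ Finset.range (m+1), (y + i)) - ∑ r ∈ Finset.range m, ((m - r : ℕ) : R) *
      ((∏ i ∈ Finset.range (r+1), (y - i)) * ∏ i ∈ Finset.range (m - r), (y + i)) := by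
  have h1 : ∑ τ ∈ fullCycles (m+1), y ^ cycleCount (finRotate (m+1) * τ) =
      ∑ S ∈ (Finset.univ.erase (0 : Fin (m+1))).powerset, (-1 : R) ^ S.card *
        ∑ τ : Perm (Fin (m+1)), (sgS S τ : R) * y ^ cycleCount (finRotate (m+1) * τ) := by
    simp_rw [Finset.mul_sum]
    rw [Finset.sum_comm]
    have : fullCycles (m+1) = Finset.univ.filter fun τ : Perm (Fin (m+1)) => ∀ x y, τ.SameCycle x y := by
      ext τ
      rw [mem_fullCycles _ (by omega)]; simp
    rw [this, Finset.sum_filter]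
    refine Finset.sum_congr rfl fun τ _ => ?_
    have h2 := congrArg (Int.cast : ℤ → R) (indicator (0 : Fin (m+1)) τ)
    push_cast at h2
    simp_rw [← mul_assoc]
    rw [← Finset.sum_mul, h2]
    split_ifs <;> simp
  rw [h1, ← Finset.add_sum_erase _ _ (Finset.empty_mem_powerset _), mul_add]
  have h2 : ∑ τ : Perm (Fin (m+1)), (sgS ∅ τ : R) * y ^ cycleCount (finRotate (m+1) * τ) =
      ∏ i ∈ Finset.range (m+1), (y + i) := by
    have := sum_fin y (1 : ℤˣ →* R) (m+1)
    simp only [MonoidHom.one_apply, one_mul] at this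
    rw [← this]
    refine Fintype.sum_equiv (Equiv.mulLeft (finRotate (m+1))) _ _ fun τ => ?_
    simp [sgS_empty]
  rw [h2, Finset.card_empty, pow_zero, one_mul, sub_eq_add_neg]
  congr 1
  rw [Finset.mul_sum]
  have h3 : ∀ r ∈ Finset.range m, ((m - r : ℕ) : R) *
      ((∏ i ∈ Finset.range (r+1), (y - i)) * ∏ i ∈ Finset.range (m - r), (y + i)) =
      ∑ s ∈ Finset.range (m - r), ((∏ i ∈ Finset.range (r+1), (y - i)) * ∏ i ∈ Finset.range (m - r), (y + i)) := by
    intro r _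
    simp
  rw [Finset.sum_congr rfl h3, Finset.sum_sigma', ← Finset.sum_neg_distrib]
  symm
  refine Finset.sum_of_injOn (fun x : (_ : ℕ) × ℕ => II m (x.2 + 1) x.1) ?_ ?_ ?_ ?_
  · rintro ⟨r, s⟩ h ⟨r', s'⟩ h' heq
    simp only [Finset.coe_sigma, Set.mem_sigma_iff, Finset.mem_coe, Finset.mem_range] at h h' heq
    have c1 := card_II m (s+1) r (by omega)
    have c2 := card_II m (s'+1) r' (by omega)
    rw [heq, c2] at c1
    have hr : r' = r := by omega
    have m1 : (⟨s+1, by omega⟩ : Fin (m+1)) ∈ II m (s+1) r := by rw [mem_II]; simp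
    have m2 : (⟨s'+1, by omega⟩ : Fin (m+1)) ∈ II m (s'+1) r' := by rw [mem_II]; simp
    rw [heq, mem_II] at m1
    rw [← heq, mem_II] at m2
    simp only at m1 m2
    have hs : s' = s := by omega
    rw [hr, hs]
  · rintro ⟨r, s⟩ h
    simp only [Finset.coe_sigma, Set.mem_sigma_iff, Finset.mem_coe, Finset.mem_range] at h
    rw [Finset.mem_coe, Finset.mem_erase, Finset.mem_powerset]
    constructor
    · intro h0
      have c1 := card_II m (s+1) r (by omega)
      simp only at h0
      rw [h0] at c1
      simp at c1
    · intro x hx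
      rw [mem_II] at hx
      rw [Finset.mem_erase]
      refine ⟨?_, Finset.mem_univ _⟩
      rintro rfl
      simp at hx
  · intro S hS hnot
    rw [Finset.mem_erase, Finset.mem_powerset] at hS
    have h0 : (0 : Fin (m+1)) ∉ S := fun h => by simpa using hS.2 h
    by_cases hu : ∀ a ∈ S, ∀ b ∈ S, finRotate (m+1) a ∉ S → finRotate (m+1) b ∉ S → a = b
    · obtain ⟨s, r, hsr, rfl⟩ := classify m S h0 (Finset.nonempty_iff_ne_empty.2 hS.1) hu
      exfalso
      apply hnot
      refine ⟨⟨r, s⟩, ?_, rfl⟩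
      simp only [Finset.coe_sigma, Set.mem_sigma_iff, Finset.mem_coe, Finset.mem_range]
      omega
    · push Not at hu
      obtain ⟨a, ha, b, hb, hca, hcb, hab⟩ := hu
      rw [H_two y S _ a b hab ha hb hca hcb]
      simp
  · rintro ⟨r, s⟩ h
    simp only [Finset.mem_sigma, Finset.mem_range] at h
    simp only
    obtain ⟨a, b, ha, hb, hv, hsg⟩ := swap_rot m s r (by omega)
    rw [mul_left_comm, H_one y _ _ a b ha hb hv, hsg, card_II _ _ _ (by omega), Fintype.card_fin]
    have e : m + 1 - (r + 1) = m - r := by omega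
    rw [e]
    push_cast
    have h5 : ((-1 : R) ^ (r+1)) * (-1) ^ (r+1) = 1 := by rw [← mul_pow]; simp
    linear_combination ((∏ i ∈ Finset.range (r+1), (y - i)) * ∏ i ∈ Finset.range (m - r), (y + i)) * h5

lemma sign_eq {α : Type*} [Fintype α] [DecidableEq α] (σ : Perm α) :
    sign σ = (-1) ^ (Fintype.card α + cycleCount σ) := by
  rw [sign_of_cycleType, ← sum_fix σ, cycleCount]
  have : σ.cycleType.sum + (Finset.univ.filter fun x => σ x = x).card +
      (Multiset.card σ.cycleType + (Finset.univ.filter fun x => σ x = x).card) =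
      σ.cycleType.sum + Multiset.card σ.cycleType + 2 * (Finset.univ.filter fun x => σ x = x).card := by ring
  rw [this, pow_add _ _ (2 * _), pow_mul]
  simp

open Polynomial in
lemma coeff_main (m k : ℕ) :
    ((m + 1 : ℕ) : ℝ) * ((m + 2 : ℕ) : ℝ) *
      (((fullCycles (m+1)).filter fun τ => cycleCount (finRotate (m+1) * τ) = k).card : ℝ) =
    (stirling1 (m + 2) k : ℝ) - (-1) ^ (m + 2 + k) * (stirling1 (m + 2) k : ℝ) := by
  have h := mul_left_cancel₀ X_ne_zero (final_alg m (X : ℝ[X]) _ (main_sum m X))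
  have h1 := sum_fin (X : ℝ[X]) (1 : ℤˣ →* ℝ[X]) (m+2)
  have h2 := sum_fin (X : ℝ[X]) (((Int.castRingHom ℝ[X] : ℤ →* ℝ[X])).comp (Units.coeHom ℤ)) (m+2)
  simp only [MonoidHom.one_apply, one_mul] at h1
  simp at h2
  simp only [← sub_eq_add_neg] at h2
  rw [← h1, ← h2] at h
  have h3 := congrArg (fun p => coeff p k) h
  simp only [coeff_sub, finsetSum_coeff, coeff_X_pow] at h3
  rw [← Nat.cast_mul, coeff_natCast_mul, finsetSum_coeff] at h3
  simp only [coeff_X_pow] at h3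
  have e1 : ∀ x : Perm (Fin (m+2)), (((sign x : ℤˣ) : ℤ) : ℝ[X]) * X ^ cycleCount x =
      C ((-1 : ℝ) ^ (m + 2 + cycleCount x)) * X ^ cycleCount x := by
    intro x
    rw [sign_eq]; simp
  simp_rw [e1, coeff_C_mul, coeff_X_pow] at h3
  have e2 : ∑ x : Perm (Fin (m+2)), (-1 : ℝ) ^ (m + 2 + cycleCount x) * (if k = cycleCount x then 1 else 0) =
      (-1) ^ (m + 2 + k) * ∑ x : Perm (Fin (m+2)), (if k = cycleCount x then 1 else 0) := by
    rw [Finset.mul_sum]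
    refine Finset.sum_congr rfl fun x _ => ?_
    split_ifs with hk
    · rw [hk]
    · simp
  rw [e2] at h3
  simp only [Finset.sum_boole, eq_comm (a := k)] at h3
  rw [stirling1]
  push_cast at h3 ⊢
  exact h3

end CycMul


/-- The number of full cycles `τ` such that `(1 2 ... n) · τ` has exactly `k` cycles is
`(2/(n(n+1))) · c(n+1,k)` if `n - k` is even, and `0` if `n - k` is odd. -/
theorem multiplication_of_full_cycles_cycle_count (n k : ℕ) (hn : 1 ≤ n) :
    (((fullCycles n).filter fun τ => cycleCount (finRotate n * τ) = k).card : ℝ) =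
      if Even ((n : ℤ) - (k : ℤ)) then 2 / ((n : ℝ) * ((n : ℝ) + 1)) * (stirling1 (n + 1) k : ℝ)
      else 0 := by
  obtain ⟨m, rfl⟩ : ∃ m, n = m + 1 := ⟨n - 1, by omega⟩
  have h := CycMul.coeff_main m k
  push_cast at h ⊢
  have hm1 : (m : ℝ) + 1 ≠ 0 := by positivity
  have hm2 : (m : ℝ) + 1 + 1 ≠ 0 := by positivity
  have hm3 : (m : ℝ) + 2 ≠ 0 := by positivity
  split_ifs with he
  · have ho : Odd (m + 2 + k) := by
      rcases he with ⟨d, hd⟩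
      exact ⟨(d + k).toNat, by omega⟩
    rw [ho.neg_one_pow] at h
    field_simp
    linear_combination h
  · have ho : Even (m + 2 + k) := by
      rw [Int.not_even_iff_odd] at he
      rcases he with ⟨d, hd⟩
      exact ⟨(d + k + 1).toNat, by omega⟩
    rw [ho.neg_one_pow, one_mul, sub_self] at h
    rcases mul_eq_zero.1 h with h | h
    · exact absurd h (mul_ne_zero hm1 hm3)
    · exact h
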